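/- Under Condition (6), for every j ∈ ℕ, the function Φ_j'(t) = ∑_{r∈ℕ^j} p_r e^{−t p_r} satisfies Φ_j'(t) ~ (Γ(β+1))^j / Γ(j(β+1)) · (log t)^{jβ+j−1} (ℓ(log t))^j / t as t → ∞ (i.e., the ratio of the two sides tends to 1). -/

import Mathlib

open Filter Topology

/-- Product weight of a box `r` in generation `j`: `p_r = p_{r 0} ⋯ p_{r (j-1)}`. -/
noncomputable def prodP (p : ℕ → ℝ) (j : ℕ) (r : Fin j → ℕ) : ℝ := ∏ i, p (r i)

/-- Counting function of generation `j`: `ρ_j(x) = #{r ∈ ℕ^j : p_r ≥ 1/x}` (as a real number). -/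
noncomputable def rhoJ (p : ℕ → ℝ) (j : ℕ) (x : ℝ) : ℝ :=
  (Nat.card {r : Fin j → ℕ // 1 / x ≤ prodP p j r} : ℝ)

/-- The derivative of the expected number of occupied boxes in generation `j`:
`Φ_j'(t) = ∑_{r ∈ ℕ^j} p_r e^{-t p_r}`. -/
noncomputable def PhiJDeriv (p : ℕ → ℝ) (j : ℕ) (t : ℝ) : ℝ :=
  ∑' r : Fin j → ℕ, prodP p j r * Real.exp (-t * prodP p j r)

open MeasureTheory

/-- Uniform convergence theorem for (additive) slowly varying measurable functions. -/
theorem uct_aux (h : ℝ → ℝ) (hm : Measurable h)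
    (hlim : ∀ u, Tendsto (fun t => h (t + u) - h t) atTop (𝓝 0)) (ε : ℝ) (hε : 0 < ε) :
    ∃ T, ∀ t ≥ T, ∀ u ∈ Set.Icc (0:ℝ) 1, |h (t + u) - h t| ≤ ε := by
  set F : ℝ → ℝ → ℝ := fun t l => min 1 |h (t + l) - h t| with hF
  have hFm : ∀ t, Measurable (F t) := by
    intro t
    simp only [hF]
    fun_prop
  have hF0 : ∀ t l, 0 ≤ F t l := fun t l => le_min zero_le_one (abs_nonneg _)
  have hF1 : ∀ t l, F t l ≤ 1 := fun t l => min_le_left _ _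
  have hFi : ∀ t a b, IntervalIntegrable (F t) volume a b := by
    intro t a b
    refine (intervalIntegrable_const (c := (1:ℝ))).mono_fun (hFm t).aestronglyMeasurable ?_
    refine Eventually.of_forall fun l => ?_
    show ‖F t l‖ ≤ ‖(1:ℝ)‖
    rw [Real.norm_of_nonneg (hF0 t l)]
    simpa using hF1 t l
  set M : ℝ → ℝ := fun t => ∫ l in (0:ℝ)..2, F t l with hM
  have hM0 : Tendsto M atTop (𝓝 0) := by
    have : Tendsto M atTop (𝓝 (∫ l in (0:ℝ)..2, (0:ℝ))) := by
      refine intervalIntegral.tendsto_integral_filter_of_dominated_convergence (fun _ => (1:ℝ))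
        (Eventually.of_forall fun t => (hFm t).aestronglyMeasurable) ?_ intervalIntegrable_const ?_
      · refine Eventually.of_forall fun t => Eventually.of_forall fun l _ => ?_
        rw [Real.norm_of_nonneg (hF0 t l)]
        exact hF1 t l
      · refine Eventually.of_forall fun l _ => ?_
        have h1 := (hlim l).abs
        rw [abs_zero] at h1
        have h2 := (tendsto_const_nhds (x := (1:ℝ))).min h1
        simpa using h2
    simpa using this
  set δ := min (1/2) (ε/2) with hδ
  have hδ0 : 0 < δ := by positivity
  obtain ⟨T, hT⟩ := eventually_atTop.1 ((tendsto_order.1 hM0).2 (δ/2) (by positivity))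
  refine ⟨T, fun t ht u hu => ?_⟩
  have key : min 1 |h (t+u) - h t| ≤ M t + M (t+u) := by
    have e1 : ∫ l in (1:ℝ)..2, F t l ≤ M t :=
      intervalIntegral.integral_mono_interval (by norm_num) (by norm_num) le_rfl
        (Eventually.of_forall (hF0 t)) (hFi _ _ _)
    have e2 : ∫ l in (1:ℝ)..2, F (t+u) (l - u) ≤ M (t+u) := by
      rw [intervalIntegral.integral_comp_sub_right (F (t+u)) u]
      exact intervalIntegral.integral_mono_interval (by linarith [hu.2]) (by linarith)
        (by linarith [hu.1]) (Eventually.of_forall (hF0 _)) (hFi _ _ _)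
    have e3 : ∫ l in (1:ℝ)..2, (min 1 |h (t+u) - h t|) ≤
        ∫ l in (1:ℝ)..2, (F t l + F (t+u) (l - u)) := by
      refine intervalIntegral.integral_mono_on (by norm_num) intervalIntegrable_const ?_ ?_
      · refine (hFi _ _ _).add ?_
        have := (hFi (t+u) (1-u) (2-u)).comp_sub_right u
        simpa using this
      · intro l _
        simp only [hF]
        have : t + u + (l - u) = t + l := by ring
        rw [this]
        have h3 : |h (t+u) - h t| ≤ |h (t+l) - h t| + |h (t+l) - h (t+u)| := by
          rw [abs_sub_comm (h (t+l)) (h (t+u)), add_comm (|h (t+l) - h t|)]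
          exact abs_sub_le _ _ _
        rcases le_total 1 |h (t+l) - h t| with h4 | h4
        · rw [min_eq_left h4]
          have := min_le_left 1 |h (t+u) - h t|
          have : 0 ≤ min 1 |h (t+l) - h (t+u)| := le_min zero_le_one (abs_nonneg _)
          linarith
        · rcases le_total 1 |h (t+l) - h (t+u)| with h5 | h5
          · rw [min_eq_left h5]
            have := min_le_left 1 |h (t+u) - h t|
            have : 0 ≤ min 1 |h (t+l) - h t| := le_min zero_le_one (abs_nonneg _)
            linarith
          · rw [min_eq_right h4, min_eq_right h5]
            exact (min_le_right _ _).trans h3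
    rw [intervalIntegral.integral_add (hFi _ _ _) (by
      have := (hFi (t+u) (1-u) (2-u)).comp_sub_right u
      simpa using this)] at e3
    simp only [intervalIntegral.integral_const, smul_eq_mul] at e3
    linarith
  have h1 := hT t ht
  have h2 := hT (t+u) (by linarith [hu.1])
  have h3 : min 1 |h (t+u) - h t| < δ := by linarith
  rcases min_lt_iff.1 h3 with h4 | h4
  · have := min_le_left (1/2:ℝ) (ε/2)
    linarith
  · have := min_le_right (1/2:ℝ) (ε/2)
    linarith

theorem uct_pot (h : ℝ → ℝ) (ε T : ℝ) (hε : 0 < ε)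
    (hT : ∀ t ≥ T, ∀ u ∈ Set.Icc (0:ℝ) 1, |h (t + u) - h t| ≤ ε) :
    ∀ n : ℕ, ∀ t ≥ T, ∀ u : ℝ, 0 ≤ u → u ≤ (n:ℝ) → h t - ε * (u + 1) ≤ h (t + u) := by
  intro n
  induction n with
  | zero =>
    intro t ht u hu hu'
    have : u = 0 := le_antisymm (by simpa using hu') hu
    subst this
    simp
    linarith
  | succ n ih =>
    intro t ht u hu hu'
    push_cast at hu'
    by_cases h1 : u ≤ 1
    · have := (abs_le.1 (hT t ht u ⟨hu, h1⟩)).1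
      nlinarith
    · push Not at h1
      have h2 := ih (t+1) (by linarith) (u-1) (by linarith) (by linarith)
      have h3 := (abs_le.1 (hT t ht 1 ⟨by norm_num, le_rfl⟩)).1
      have : t + 1 + (u - 1) = t + u := by ring
      rw [this] at h2
      nlinarith

/-- A measurable regularly varying function of positive index is almost increasing. -/
theorem almostInc_aux (D : ℝ → ℝ) (hm : Measurable D) (β : ℝ) (hβ : 0 < β)
    (hpos : ∀ᶠ x in atTop, 0 < D x)
    (hrv : ∀ c > 0, Tendsto (fun x => D (c * x) / D x) atTop (𝓝 (c ^ β))) :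
    ∃ C > 0, ∃ X > 0, ∀ z x, X ≤ z → z ≤ x → D z ≤ C * D x := by
  set h : ℝ → ℝ := fun t => Real.log (D (Real.exp t)) - β * t with hh
  have hlim : ∀ u, Tendsto (fun t => h (t + u) - h t) atTop (𝓝 0) := by
    intro u
    have h1 := (hrv (Real.exp u) (Real.exp_pos u)).comp Real.tendsto_exp_atTop
    have h2 := h1.log (by positivity)
    have h3 := h2.sub_const (β * u)
    rw [Real.log_rpow (Real.exp_pos u), Real.log_exp, sub_self] at h3
    refine h3.congr' ?_
    have hp2 := Real.tendsto_exp_atTop.eventually hpos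
    have hp3 := (tendsto_atTop_add_const_right _ u tendsto_id).eventually hp2
    filter_upwards [hp2, hp3] with t ht1 ht2
    simp only [id] at ht2
    simp only [Function.comp, hh]
    rw [Real.exp_add, mul_comm] at ht2
    rw [Real.log_div ht2.ne' ht1.ne', Real.exp_add, mul_comm (Real.exp t)]
    ring
  obtain ⟨T, hT⟩ := uct_aux h (by fun_prop) hlim β hβ
  obtain ⟨X, hX⟩ := eventually_atTop.1 hpos
  refine ⟨Real.exp β, Real.exp_pos _, max (max X (Real.exp T)) 1, by positivity, fun z x hz hzx => ?_⟩
  have hz1 : 1 ≤ z := (le_max_right _ _).trans hz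
  have hzX : X ≤ z := ((le_max_left _ _).trans (le_max_left _ _)).trans hz
  have hzT : Real.exp T ≤ z := ((le_max_right _ _).trans (le_max_left _ _)).trans hz
  have hz0 : 0 < z := by linarith
  have hx0 : 0 < x := by linarith
  have hTl : T ≤ Real.log z := (Real.le_log_iff_exp_le hz0).2 hzT
  have hlog : Real.log z ≤ Real.log x := Real.log_le_log hz0 hzx
  obtain ⟨n, hn⟩ := exists_nat_ge (Real.log x - Real.log z)
  have := uct_pot h β T hβ hT n (Real.log z) hTl (Real.log x - Real.log z) (by linarith) hn
  have e : Real.log z + (Real.log x - Real.log z) = Real.log x := by ring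
  rw [e] at this
  simp only [hh, Real.exp_log hz0, Real.exp_log hx0] at this
  have h5 : Real.log (D z) ≤ β + Real.log (D x) := by nlinarith
  have hDz := hX z hzX
  have hDx := hX x (hzX.trans hzx)
  rw [← Real.log_le_log_iff hDz (by positivity), Real.log_mul (Real.exp_pos _).ne' hDx.ne',
    Real.log_exp]
  exact h5

/-- The kernel `k(s) = e^{s - e^s}`. -/
noncomputable def kk (s : ℝ) : ℝ := Real.exp (s - Real.exp s)

/-- The derivative of the kernel. -/
noncomputable def kd (s : ℝ) : ℝ := (1 - Real.exp s) * Real.exp (s - Real.exp s)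

theorem kk_pos (s : ℝ) : 0 < kk s := Real.exp_pos _

theorem kk_le (s : ℝ) : kk s ≤ Real.exp s :=
  Real.exp_le_exp.2 (by linarith [Real.exp_pos s])

theorem kk_deriv (s : ℝ) : HasDerivAt kk (kd s) s := by
  have h := ((hasDerivAt_id s).sub (Real.hasDerivAt_exp s)).exp
  refine (h.congr_deriv ?_).congr_of_eventuallyEq (Eventually.of_forall fun x => rfl)
  show Real.exp (s - Real.exp s) * (1 - Real.exp s) = kd s
  unfold kd
  ring

theorem kd_cont : Continuous kd := by unfold kd; fun_prop

theorem kd_le_exp (s : ℝ) : |kd s| ≤ Real.exp s := by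
  unfold kd
  rw [abs_mul, abs_of_pos (Real.exp_pos _), Real.exp_sub]
  have hq := Real.exp_pos s
  have h1 : |1 - Real.exp s| ≤ Real.exp (Real.exp s) := by
    have := Real.add_one_le_exp (Real.exp s)
    rw [abs_le]; constructor <;> linarith
  calc |1 - Real.exp s| * (Real.exp s / Real.exp (Real.exp s))
      ≤ Real.exp (Real.exp s) * (Real.exp s / Real.exp (Real.exp s)) := by gcongr
    _ = Real.exp s := by field_simp

theorem exp_cube (q : ℝ) (hq : 0 ≤ q) : q ^ 3 ≤ 6 * Real.exp q := by
  have := Real.pow_div_factorial_le_exp q hq 3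
  norm_num [Nat.factorial] at this
  linarith

theorem kk_le_abs (s : ℝ) : kk s ≤ 6 * Real.exp (-|s|) := by
  rcases le_total s 0 with h | h
  · rw [abs_of_nonpos h, neg_neg]
    have := kk_le s
    have := Real.exp_pos s
    linarith
  · rw [abs_of_nonneg h]
    unfold kk
    rw [Real.exp_sub, Real.exp_neg]
    have h1 : 1 ≤ Real.exp s := Real.one_le_exp h
    have h2 := exp_cube (Real.exp s) (by linarith)
    rw [div_le_iff₀ (Real.exp_pos _)]
    have h3 : Real.exp s * Real.exp s ≤ 6 * Real.exp (Real.exp s) := by nlinarith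
    calc Real.exp s = (Real.exp s * Real.exp s) * (Real.exp s)⁻¹ := by field_simp
      _ ≤ (6 * Real.exp (Real.exp s)) * (Real.exp s)⁻¹ := by gcongr
      _ = _ := by ring

theorem kd_le_abs (s : ℝ) : |kd s| ≤ 6 * Real.exp (-|s|) := by
  rcases le_total s 0 with h | h
  · rw [abs_of_nonpos h, neg_neg]
    have := kd_le_exp s
    have := Real.exp_pos s
    linarith
  · rw [abs_of_nonneg h]
    unfold kd
    have h1 : 1 ≤ Real.exp s := Real.one_le_exp h
    rw [abs_mul, abs_of_pos (Real.exp_pos _), Real.exp_sub, Real.exp_neg, abs_of_nonpos (by linarith)]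
    have h2 := exp_cube (Real.exp s) (by linarith)
    calc -(1 - Real.exp s) * (Real.exp s / Real.exp (Real.exp s))
        ≤ Real.exp s * (Real.exp s / Real.exp (Real.exp s)) := by gcongr; linarith
      _ = (Real.exp s ^ 3) / Real.exp (Real.exp s) * (Real.exp s)⁻¹ := by field_simp
      _ ≤ (6 * Real.exp (Real.exp s)) / Real.exp (Real.exp s) * (Real.exp s)⁻¹ := by gcongr
      _ = _ := by field_simp

theorem int_exp_abs (c : ℝ) (hc : 0 < c) : Integrable (fun s : ℝ => Real.exp (-(c * |s|))) := by
  have h1 : IntegrableOn (fun s : ℝ => Real.exp (-(c * |s|))) (Set.Ioi 0) := by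
    refine (integrableOn_Ioi_comp_mul_left_iff (fun s => Real.exp (-s)) 0 hc).2 ?_ |>.congr_fun ?_
      measurableSet_Ioi
    · simpa using integrableOn_exp_neg_Ioi 0
    · intro s hs
      simp only [abs_of_pos (Set.mem_Ioi.1 hs)]
  have h2 := h1.comp_neg
  simp only [abs_neg, Set.neg_Ioi, neg_zero] at h2
  have h3 := ((integrableOn_Iic_iff_integrableOn_Iio (by simp)).2 h2).union h1
  rwa [Set.Iic_union_Ioi, integrableOn_univ] at h3

/-- The dominating function -/
theorem dom_bound (s : ℝ) :
    |kd s| * ((|s| + 2) * Real.exp ((|s| + 1) / 2)) ≤ 96 * Real.exp (-(1/4 * |s|)) := by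
  have h1 := kd_le_abs s
  have h2 : |s| + 2 ≤ 8 * Real.exp (|s|/4) := by
    have := Real.add_one_le_exp (|s|/4)
    have := abs_nonneg s
    linarith
  have h3 : Real.exp ((|s|+1)/2) ≤ 2 * Real.exp (|s|/2) := by
    rw [add_div, Real.exp_add, mul_comm]
    gcongr
    have := Real.exp_one_lt_d9
    have e : Real.exp (1/2) * Real.exp (1/2) = Real.exp 1 := by rw [← Real.exp_add]; norm_num
    nlinarith [Real.exp_pos (1/2)]
  calc |kd s| * ((|s| + 2) * Real.exp ((|s| + 1) / 2))
      ≤ (6 * Real.exp (-|s|)) * ((8 * Real.exp (|s|/4)) * (2 * Real.exp (|s|/2))) := by gcongr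
    _ = 96 * (Real.exp (-|s|) * Real.exp (|s|/4) * Real.exp (|s|/2)) := by ring
    _ = _ := by rw [← Real.exp_add, ← Real.exp_add]; congr 2; ring

theorem kd_dom_int : Integrable (fun s => |kd s| * ((|s| + 2) * Real.exp ((|s| + 1) / 2))) := by
  refine ((int_exp_abs (1/4) (by norm_num)).const_mul 96).mono' ?_ (Eventually.of_forall fun s => ?_)
  · have := kd_cont
    exact (by fun_prop : Continuous _).aestronglyMeasurable
  · rw [Real.norm_of_nonneg (by positivity)]
    exact dom_bound s

theorem kd_int : Integrable kd := by
  refine kd_dom_int.mono' kd_cont.aestronglyMeasurable (Eventually.of_forall fun s => ?_)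
  have : 1 ≤ (|s| + 2) * Real.exp ((|s| + 1) / 2) := by
    have h1 : 1 ≤ Real.exp ((|s| + 1) / 2) := Real.one_le_exp (by positivity)
    nlinarith [abs_nonneg s]
  rw [Real.norm_eq_abs]
  exact le_mul_of_one_le_right (abs_nonneg _) this

theorem skd_int : Integrable (fun s => kd s * (-s)) := by
  refine kd_dom_int.mono' (by have := kd_cont; exact (by fun_prop : Continuous _).aestronglyMeasurable) (Eventually.of_forall fun s => ?_)
  have : |s| ≤ (|s| + 2) * Real.exp ((|s| + 1) / 2) := by
    have h1 : 1 ≤ Real.exp ((|s| + 1) / 2) := Real.one_le_exp (by positivity)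
    nlinarith [abs_nonneg s]
  rw [Real.norm_eq_abs, abs_mul, abs_neg]
  gcongr

theorem skk_le (s : ℝ) : |s * kk s| ≤ 12 * Real.exp (-(1/2 * |s|)) := by
  rw [abs_mul, abs_of_pos (kk_pos s)]
  have h1 := kk_le_abs s
  have h2 : |s| ≤ 2 * Real.exp (|s|/2) := by
    have := Real.add_one_le_exp (|s|/2)
    linarith
  calc |s| * kk s ≤ (2 * Real.exp (|s|/2)) * (6 * Real.exp (-|s|)) := by
        have := (kk_pos s).le
        gcongr
    _ = 12 * (Real.exp (|s|/2) * Real.exp (-|s|)) := by ring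
    _ = _ := by rw [← Real.exp_add]; congr 2; ring

theorem tend_exp_abs {l : Filter ℝ} (hl : Tendsto (fun s : ℝ => |s|) l atTop) (c : ℝ) (hc : 0 < c) :
    Tendsto (fun s : ℝ => Real.exp (-(c * |s|))) l (𝓝 0) :=
  Real.tendsto_exp_atBot.comp (tendsto_neg_atTop_atBot.comp (hl.const_mul_atTop hc))

theorem kk_tend {l : Filter ℝ} (hl : Tendsto (fun s : ℝ => |s|) l atTop) : Tendsto kk l (𝓝 0) := by
  refine squeeze_zero (fun s => (kk_pos s).le) (fun s => kk_le_abs s) ?_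
  have := (tend_exp_abs hl 1 one_pos).const_mul 6
  simpa using this

theorem skk_tend {l : Filter ℝ} (hl : Tendsto (fun s : ℝ => |s|) l atTop) :
    Tendsto (fun s => s * kk s) l (𝓝 0) := by
  refine squeeze_zero_norm (fun s => skk_le s) ?_
  have := (tend_exp_abs hl (1/2) (by norm_num)).const_mul 12
  simpa using this

theorem integral_kd : ∫ s, kd s = 0 := by
  have := integral_of_hasDerivAt_of_tendsto kk_deriv kd_int (kk_tend tendsto_abs_atBot_atTop)
    (kk_tend tendsto_abs_atTop_atTop)
  simpa using this

theorem integral_skd : ∫ s, kd s * (-s) = 1 := by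
  have h : ∀ s, HasDerivAt (fun s => -(s * kk s) - Real.exp (-Real.exp s)) (kd s * (-s)) s := by
    intro s
    have h1 := ((hasDerivAt_id s).mul (kk_deriv s)).neg
    have h2 := ((Real.hasDerivAt_exp s).neg).exp
    have h3 := h1.sub h2
    refine (h3.congr_deriv ?_).congr_of_eventuallyEq (Eventually.of_forall fun x => rfl)
    show -(1 * kk s + s * kd s) - Real.exp (-Real.exp s) * -Real.exp s = _
    have : kk s = Real.exp (-Real.exp s) * Real.exp s := by
      unfold kk
      rw [← Real.exp_add]; congr 1; ring
    rw [this]; ring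
  have hb : Tendsto (fun s => -(s * kk s) - Real.exp (-Real.exp s)) atBot (𝓝 (-1)) := by
    have h1 := (skk_tend tendsto_abs_atBot_atTop).neg
    have h2 : Tendsto (fun s => Real.exp (-Real.exp s)) atBot (𝓝 (Real.exp (-0))) :=
      (Real.continuous_exp.tendsto _).comp Real.tendsto_exp_atBot.neg
    have := h1.sub h2
    simpa using this
  have ht : Tendsto (fun s => -(s * kk s) - Real.exp (-Real.exp s)) atTop (𝓝 0) := by
    have h1 := (skk_tend tendsto_abs_atTop_atTop).neg
    have h2 : Tendsto (fun s => Real.exp (-Real.exp s)) atTop (𝓝 0) :=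
      Real.tendsto_exp_atBot.comp (tendsto_neg_atTop_atBot.comp Real.tendsto_exp_atTop)
    have := h1.sub h2
    simpa using this
  rw [integral_of_hasDerivAt_of_tendsto h skd_int hb ht]
  norm_num

theorem integral_kd_Iic (b : ℝ) : ∫ s in Set.Iic b, kd s = kk b := by
  rw [integral_Iic_of_hasDerivAt_of_tendsto (kk_deriv b).continuousAt.continuousWithinAt
    (fun s _ => kk_deriv s) kd_int.integrableOn (kk_tend tendsto_abs_atBot_atTop), sub_zero]

/-- Counting function of the family `a`. -/
noncomputable def UU {ι : Type*} (a : ι → ℝ) (y : ℝ) : ℝ := ∑' i, if a i ≤ y then (1:ℝ) else 0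

section
variable {ι : Type*} (a : ι → ℝ)

theorem UU_fin (hs : Summable fun i => Real.exp (-a i)) (y : ℝ) : {i | a i ≤ y}.Finite := by
  have h := hs.tendsto_cofinite_zero
  have h2 := (tendsto_order.1 h).2 (Real.exp (-y)) (Real.exp_pos _)
  rw [Filter.eventually_cofinite] at h2
  refine h2.subset fun i hi => ?_
  simp only [Set.mem_ofPred_eq, not_lt] at hi ⊢
  exact Real.exp_le_exp.2 (by linarith)

theorem UU_summable (hs : Summable fun i => Real.exp (-a i)) (y : ℝ) :
    Summable fun i => if a i ≤ y then (1:ℝ) else 0 := by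
  refine summable_of_hasFiniteSupport ((UU_fin a hs y).subset fun i hi => ?_)
  simp only [Function.mem_support, ne_eq, ite_eq_right_iff, not_forall] at hi
  exact hi.1

theorem UU_mono (hs : Summable fun i => Real.exp (-a i)) : Monotone (UU a) := by
  intro x y hxy
  refine (UU_summable a hs x).tsum_le_tsum (fun i => ?_) (UU_summable a hs y)
  split_ifs with h1 h2 h2
  · exact le_rfl
  · exact absurd (h1.trans hxy) h2
  · exact zero_le_one
  · exact le_rfl

theorem UU_neg (ha : ∀ i, 0 ≤ a i) (y : ℝ) (hy : y < 0) : UU a y = 0 := by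
  unfold UU
  have : (fun i => if a i ≤ y then (1:ℝ) else 0) = fun _ => 0 := by
    funext i
    rw [if_neg]
    linarith [ha i]
  rw [this, tsum_zero]

theorem UU_nonneg (y : ℝ) : 0 ≤ UU a y := tsum_nonneg fun i => by split_ifs <;> norm_num

theorem UU_card (hs : Summable fun i => Real.exp (-a i)) (y : ℝ) :
    UU a y = Nat.card {i // a i ≤ y} := by
  have hf := UU_fin a hs y
  unfold UU
  rw [tsum_eq_sum (s := hf.toFinset) (fun i hi => by
    rw [if_neg]
    simpa using hi)]
  rw [Finset.sum_congr rfl (g := fun _ => (1:ℝ)) (fun i hi => by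
    rw [if_pos]
    simpa using hi)]
  simp only [Finset.sum_const, nsmul_eq_mul, mul_one]
  congr 1
  have : Nat.card {i // a i ≤ y} = Set.ncard {i | a i ≤ y} := rfl
  rw [this, Set.ncard_eq_toFinset_card _ hf]

theorem base_abel [Countable ι] (hs : Summable fun i => Real.exp (-a i)) (x : ℝ) :
    ∑' i, kk (x - a i) = ∫ s, kd s * UU a (x - s) := by
  have hFi : ∀ i, (fun s => kd s * (if a i ≤ x - s then (1:ℝ) else 0)) =
      (Set.Iic (x - a i)).indicator kd := by
    intro i
    funext s
    by_cases h : a i ≤ x - s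
    · rw [if_pos h, Set.indicator_of_mem (by simp only [Set.mem_Iic]; linarith), mul_one]
    · rw [if_neg h, Set.indicator_of_notMem (by simp only [Set.mem_Iic]; intro; apply h; linarith), mul_zero]
  have h := hasSum_integral_of_summable_integral_norm (μ := volume)
    (F := fun i s => kd s * (if a i ≤ x - s then (1:ℝ) else 0)) ?_ ?_
  · have e1 : ∀ i, ∫ s, kd s * (if a i ≤ x - s then (1:ℝ) else 0) = kk (x - a i) := by
      intro i
      rw [hFi, integral_indicator measurableSet_Iic, integral_kd_Iic]
    simp only [e1] at h
    rw [h.tsum_eq]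
    congr 1
    funext s
    rw [tsum_mul_left]
    rfl
  · intro i
    rw [hFi]
    exact kd_int.indicator measurableSet_Iic
  · refine Summable.of_nonneg_of_le (fun i => integral_nonneg fun s => norm_nonneg _) (fun i => ?_)
      (hs.mul_left (Real.exp x))
    rw [← Real.exp_add, ← sub_eq_add_neg, ← integral_exp_Iic, ← integral_indicator measurableSet_Iic]
    refine integral_mono_of_nonneg (Eventually.of_forall fun s => norm_nonneg _)
      ((integrableOn_exp_Iic _).integrable_indicator measurableSet_Iic) (Eventually.of_forall fun s => ?_)
    show ‖kd s * (if a i ≤ x - s then (1:ℝ) else 0)‖ ≤ _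
    by_cases h : a i ≤ x - s
    · rw [if_pos h, Set.indicator_of_mem (by simp only [Set.mem_Iic]; linarith), mul_one]
      exact kd_le_exp s
    · rw [if_neg h, mul_zero, norm_zero]
      exact Set.indicator_nonneg (fun s _ => (Real.exp_pos s).le) s

theorem base_bound (hs : Summable fun i => Real.exp (-a i)) (g : ℝ → ℝ) (C X : ℝ)
    (hC : 0 < C) (hg : ∀ x ≥ X, 0 < g x)
    (hD : ∀ x ≥ X, ∀ y ≤ x, UU a y - UU a (y - 1) ≤ C * g x)
    (hg1 : ∀ x ≥ X, g (x + 1) ≤ Real.exp (1/2) * g x) (x : ℝ) (hx : X ≤ x) (s : ℝ) :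
    |UU a (x - s) - UU a x| ≤ C * ((|s| + 2) * Real.exp ((|s| + 1) / 2)) * g x := by
  have hm := UU_mono a hs
  have hn : ∀ x ≥ X, ∀ n : ℕ, UU a x - UU a (x - n) ≤ n * (C * g x) := by
    intro x hx n
    induction n with
    | zero => simp
    | succ n ih =>
      have := hD x hx (x - n) (by have : (0:ℝ) ≤ n := n.cast_nonneg
                                  linarith)
      push_cast
      have e : x - (n + 1 : ℝ) = x - n - 1 := by ring
      rw [e]
      linarith
  have hgn : ∀ n : ℕ, g (x + n) ≤ Real.exp (n / 2) * g x := by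
    intro n
    induction n with
    | zero => simp
    | succ n ih =>
      have := hg1 (x + n) (by have : (0:ℝ) ≤ n := n.cast_nonneg
                              linarith)
      push_cast
      rw [add_div, Real.exp_add, ← add_assoc]
      calc g (x + n + 1) ≤ Real.exp (1/2) * g (x + n) := this
        _ ≤ Real.exp (1/2) * (Real.exp (n/2) * g x) := by gcongr
        _ = _ := by ring
  have hgx := hg x hx
  rcases le_total 0 s with h | h
  · rw [abs_of_nonneg h, abs_of_nonpos (by have := hm (by linarith : x - s ≤ x); linarith)]
    have h1 := hn x hx ⌈s⌉₊
    have h2 := hm (by linarith [Nat.le_ceil s] : x - (⌈s⌉₊:ℝ) ≤ x - s)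
    have h3 := (Nat.ceil_lt_add_one h).le
    have h4 : 1 ≤ Real.exp ((s+1)/2) := Real.one_le_exp (by linarith)
    calc -(UU a (x - s) - UU a x) ≤ ⌈s⌉₊ * (C * g x) := by linarith
      _ ≤ ((s + 2) * Real.exp ((s+1)/2)) * (C * g x) := by
          gcongr
          nlinarith
      _ = _ := by ring
  · rw [abs_of_nonpos h, abs_of_nonneg (by have := hm (by linarith : x ≤ x - s); linarith)]
    have hc : (0:ℝ) ≤ ⌈-s⌉₊ := Nat.cast_nonneg _
    have h1 := hn (x + ⌈-s⌉₊) (by linarith) ⌈-s⌉₊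
    rw [add_sub_cancel_right] at h1
    have h2 := hm (by linarith [Nat.le_ceil (-s)] : x - s ≤ x + (⌈-s⌉₊:ℝ))
    have h3 := (Nat.ceil_lt_add_one (by linarith : 0 ≤ -s)).le
    calc UU a (x - s) - UU a x ≤ ⌈-s⌉₊ * (C * g (x + ⌈-s⌉₊)) := by linarith
      _ ≤ ⌈-s⌉₊ * (C * (Real.exp (⌈-s⌉₊ / 2) * g x)) := by
          gcongr
          exact hgn _
      _ ≤ (-s + 2) * (C * (Real.exp ((-s+1)/2) * g x)) := by
          gcongr
          all_goals linarith
      _ = _ := by ring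

theorem base_lim [Countable ι] (hs : Summable fun i => Real.exp (-a i)) (g : ℝ → ℝ) (C X : ℝ)
    (hC : 0 < C) (hg : ∀ x ≥ X, 0 < g x)
    (hD : ∀ x ≥ X, ∀ y ≤ x, UU a y - UU a (y - 1) ≤ C * g x)
    (hg1 : ∀ x ≥ X, g (x + 1) ≤ Real.exp (1/2) * g x)
    (hU : ∀ h, Tendsto (fun x => (UU a (x + h) - UU a x) / g x) atTop (𝓝 h)) :
    Tendsto (fun x => (∑' i, kk (x - a i)) / g x) atTop (𝓝 1) := by
  have hm := UU_mono a hs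
  have hmeas : ∀ x, Measurable fun s => kd s * (UU a (x - s) - UU a x) := by
    intro x
    have := kd_cont.measurable
    have := hm.measurable
    fun_prop
  have hdom : ∀ x ≥ X, ∀ s, ‖kd s * ((UU a (x - s) - UU a x) / g x)‖ ≤
      C * (|kd s| * ((|s| + 2) * Real.exp ((|s| + 1) / 2))) := by
    intro x hx s
    have h1 := base_bound a hs g C X hC hg hD hg1 x hx s
    have hgx := hg x hx
    rw [Real.norm_eq_abs, abs_mul, abs_div, abs_of_pos hgx]
    calc |kd s| * (|UU a (x - s) - UU a x| / g x)
        ≤ |kd s| * (C * ((|s| + 2) * Real.exp ((|s| + 1) / 2))) := by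
          gcongr
          rw [div_le_iff₀ hgx]
          exact h1
      _ = _ := by ring
  have hmain : Tendsto (fun x => ∫ s, kd s * ((UU a (x - s) - UU a x) / g x)) atTop
      (𝓝 (∫ s, kd s * (-s))) := by
    refine tendsto_integral_filter_of_dominated_convergence
      (fun s => C * (|kd s| * ((|s| + 2) * Real.exp ((|s| + 1) / 2)))) ?_ ?_ ?_ ?_
    · refine Eventually.of_forall fun x => ?_
      have := (hmeas x).div_const (g x)
      simp only [mul_div_assoc] at this
      exact this.aestronglyMeasurable
    · filter_upwards [eventually_ge_atTop X] with x hx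
      exact Eventually.of_forall fun s => hdom x hx s
    · exact kd_dom_int.const_mul C
    · refine Eventually.of_forall fun s => ?_
      have := (hU (-s)).const_mul (kd s)
      simpa [sub_eq_add_neg] using this
  rw [integral_skd] at hmain
  refine hmain.congr' ?_
  filter_upwards [eventually_ge_atTop X] with x hx
  have hgx := hg x hx
  rw [base_abel a hs x]
  have i1 : Integrable (fun s => kd s * (UU a (x - s) - UU a x)) := by
    have h2 : Integrable (fun s => kd s * ((UU a (x - s) - UU a x) / g x)) := by
      refine (kd_dom_int.const_mul C).mono' ?_ (Eventually.of_forall fun s => hdom x hx s)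
      have := (hmeas x).div_const (g x)
      simp only [mul_div_assoc] at this
      exact this.aestronglyMeasurable
    refine (h2.mul_const (g x)).congr (Eventually.of_forall fun s => ?_)
    show kd s * ((UU a (x - s) - UU a x) / g x) * g x = _
    field_simp
  have e1 : ∫ s, kd s * UU a (x - s) = ∫ s, kd s * (UU a (x - s) - UU a x) := by
    have h3 : ∀ s, kd s * UU a (x - s) = kd s * (UU a (x - s) - UU a x) + kd s * UU a x := by
      intro s; ring
    simp only [h3]
    rw [integral_add i1 (kd_int.mul_const _), integral_mul_const, integral_kd]
    ring
  rw [e1, ← integral_div]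
  congr 1
  funext s
  ring

end

section
variable {ι : Type*} (a : ι → ℝ)

/-- Restriction of `f` to the nonnegative half line. -/
noncomputable def FF (f : ℝ → ℝ) (z : ℝ) : ℝ := if 0 ≤ z then f z else 0

/-- Average of `FF f` over `[z-1,z]`. -/
noncomputable def barF (f : ℝ → ℝ) (z : ℝ) : ℝ := ∫ u in Set.Ico (0:ℝ) 1, FF f (z - u)

theorem FF_meas (f : ℝ → ℝ) (hf : Measurable f) : Measurable (FF f) :=
  Measurable.ite measurableSet_Ici hf measurable_const

theorem FF_nonneg (f : ℝ → ℝ) (hf0 : ∀ z, 0 ≤ f z) (z : ℝ) : 0 ≤ FF f z := by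
  unfold FF; split_ifs
  · exact hf0 z
  · exact le_rfl

theorem FF_le (f : ℝ → ℝ) (hf1 : ∀ z, f z ≤ Real.exp z) (z : ℝ) :
    FF f z ≤ Real.exp z := by
  unfold FF; split_ifs
  · exact hf1 z
  · exact (Real.exp_pos z).le

theorem barF_nonneg (f : ℝ → ℝ) (hf0 : ∀ z, 0 ≤ f z) (z : ℝ) : 0 ≤ barF f z :=
  integral_nonneg fun _ => FF_nonneg f hf0 _

theorem barF_int (f : ℝ → ℝ) (hf : Measurable f) (hf0 : ∀ z, 0 ≤ f z)
    (hf1 : ∀ z, f z ≤ Real.exp z) (z : ℝ) :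
    IntegrableOn (fun u => FF f (z - u)) (Set.Ico (0:ℝ) 1) := by
  refine Integrable.mono' (g := fun _ => Real.exp z) (integrable_const _)
    ((FF_meas f hf).comp (measurable_const.sub measurable_id)).aestronglyMeasurable ?_
  refine (ae_restrict_iff' measurableSet_Ico).2 (Eventually.of_forall fun u hu => ?_)
  rw [Real.norm_of_nonneg (FF_nonneg f hf0 _)]
  exact (FF_le f hf1 _).trans (Real.exp_le_exp.2 (by linarith [hu.1]))

theorem barF_le (f : ℝ → ℝ) (hf : Measurable f) (hf0 : ∀ z, 0 ≤ f z)
    (hf1 : ∀ z, f z ≤ Real.exp z) (z : ℝ) : barF f z ≤ Real.exp z := by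
  have : barF f z ≤ ∫ u in Set.Ico (0:ℝ) 1, Real.exp z := by
    refine setIntegral_mono_on (barF_int f hf hf0 hf1 z) (integrable_const _) measurableSet_Ico ?_
    intro u hu
    exact (FF_le f hf1 _).trans (Real.exp_le_exp.2 (by linarith [hu.1]))
  simpa using this

theorem barF_tsum [Countable ι] (hs : Summable fun i => Real.exp (-a i))
    (f : ℝ → ℝ) (hf : Measurable f) (hf0 : ∀ z, 0 ≤ f z) (hf1 : ∀ z, f z ≤ Real.exp z) (x : ℝ) :
    ∑' i, barF f (x - a i) = ∫ y, FF f (x - y) * (UU a y - UU a (y - 1)) := by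
  have hFi : ∀ i, (fun y => FF f (x - y) * ((if a i ≤ y then (1:ℝ) else 0) -
      (if a i ≤ y - 1 then (1:ℝ) else 0))) =
      fun y => (Set.Ico (0:ℝ) 1).indicator (fun u => FF f ((x - a i) - u)) (y - a i) := by
    intro i
    funext y
    have e : x - a i - (y - a i) = x - y := by ring
    by_cases h : a i ≤ y - 1
    · rw [if_pos h, if_pos (by linarith), Set.indicator_of_notMem (by
        simp only [Set.mem_Ico, not_and, not_lt]; intro; linarith)]
      ring
    · by_cases h' : a i ≤ y
      · rw [if_neg h, if_pos h', Set.indicator_of_mem (by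
          simp only [Set.mem_Ico]; constructor <;> linarith), e]
        ring
      · rw [if_neg h, if_neg h', Set.indicator_of_notMem (by
          simp only [Set.mem_Ico, not_and, not_lt]; intro; linarith)]
        ring
  have hinteg : ∀ i, ∫ y, FF f (x - y) * ((if a i ≤ y then (1:ℝ) else 0) -
      (if a i ≤ y - 1 then (1:ℝ) else 0)) = barF f (x - a i) := by
    intro i
    rw [hFi, integral_sub_right_eq_self
      (fun y => (Set.Ico (0:ℝ) 1).indicator (fun u => FF f ((x - a i) - u)) y) (a i),
      integral_indicator measurableSet_Ico]
    rfl
  have h := hasSum_integral_of_summable_integral_norm (μ := volume)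
    (F := fun i y => FF f (x - y) * ((if a i ≤ y then (1:ℝ) else 0) -
      (if a i ≤ y - 1 then (1:ℝ) else 0))) ?_ ?_
  · simp only [hinteg] at h
    rw [h.tsum_eq]
    congr 1
    funext y
    rw [tsum_mul_left, (UU_summable a hs y).tsum_sub (UU_summable a hs (y-1))]
    rfl
  · intro i
    rw [hFi]
    exact ((barF_int f hf hf0 hf1 (x - a i)).integrable_indicator measurableSet_Ico).comp_sub_right (a i)
  · refine Summable.of_nonneg_of_le (fun i => integral_nonneg fun s => norm_nonneg _) (fun i => ?_)
      (hs.mul_left (Real.exp x))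
    rw [← Real.exp_add, ← sub_eq_add_neg]
    have e : ∀ y, ‖FF f (x - y) * ((if a i ≤ y then (1:ℝ) else 0) -
      (if a i ≤ y - 1 then (1:ℝ) else 0))‖ = FF f (x - y) * ((if a i ≤ y then (1:ℝ) else 0) -
      (if a i ≤ y - 1 then (1:ℝ) else 0)) := by
      intro y
      refine Real.norm_of_nonneg (mul_nonneg (FF_nonneg f hf0 _) ?_)
      split_ifs <;> linarith
    simp only [e]
    rw [hinteg]
    exact barF_le f hf hf0 hf1 _

theorem barF_ratio (f G : ℝ → ℝ) (hf : Measurable f) (hf0 : ∀ z, 0 ≤ f z)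
    (C X : ℝ) (hG : ∀ x ≥ X, 0 < G x)
    (hfG : ∀ x ≥ X, ∀ z, 0 ≤ z → z ≤ x → f z ≤ C * G x)
    (hlim : Tendsto (fun x => f x / G x) atTop (𝓝 1))
    (hsh : ∀ u, Tendsto (fun x => G (x - u) / G x) atTop (𝓝 1)) :
    Tendsto (fun z => barF f z / G z) atTop (𝓝 1) := by
  have h1 : Tendsto (fun z => ∫ u in Set.Ico (0:ℝ) 1, FF f (z - u) / G z) atTop
      (𝓝 (∫ u in Set.Ico (0:ℝ) 1, (1:ℝ))) := by
    refine tendsto_integral_filter_of_dominated_convergence (fun _ => |C|) ?_ ?_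
      (integrable_const _) ?_
    · exact Eventually.of_forall fun z => (((FF_meas f hf).comp
        (measurable_const.sub measurable_id)).div_const _).aestronglyMeasurable
    · filter_upwards [eventually_ge_atTop X] with z hz
      refine (ae_restrict_iff' measurableSet_Ico).2 (Eventually.of_forall fun u hu => ?_)
      have hGz := hG z hz
      rw [Real.norm_of_nonneg (div_nonneg (FF_nonneg f hf0 _) hGz.le), div_le_iff₀ hGz]
      unfold FF
      split_ifs with h
      · refine (hfG z hz (z - u) h (by linarith [hu.1])).trans ?_
        gcongr
        exact le_abs_self C
      · positivity
    · refine Eventually.of_forall fun u => ?_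
      have ht : Tendsto (fun z : ℝ => z - u) atTop atTop := tendsto_atTop_add_const_right _ (-u) tendsto_id
      have h2 := (hlim.comp ht).mul (hsh u)
      rw [one_mul] at h2
      refine h2.congr' ?_
      filter_upwards [eventually_ge_atTop u, ht.eventually (eventually_ge_atTop X)] with z hz hz2
      have := hG _ hz2
      simp only [Function.comp, FF]
      rw [if_pos (by linarith)]
      field_simp
  simp only [integral_div] at h1
  simpa [barF] using h1

theorem compare_aux (f G : ℝ → ℝ) (hf : Measurable f) (hf0 : ∀ z, 0 ≤ f z)
    (hf1 : ∀ z, f z ≤ Real.exp z)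
    (C X : ℝ) (hG : ∀ x ≥ X, 0 < G x)
    (hfG : ∀ x ≥ X, ∀ z, 0 ≤ z → z ≤ x → f z ≤ C * G x)
    (hlim : Tendsto (fun x => f x / G x) atTop (𝓝 1))
    (hsh : ∀ u, Tendsto (fun x => G (x - u) / G x) atTop (𝓝 1)) (ε : ℝ) (hε : 0 < ε) :
    ∃ K ≥ 0, ∀ z, |f z - barF f z| ≤ ε * f z + K * kk z := by
  have h1 := barF_ratio f G hf hf0 C X hG hfG hlim hsh
  have h2 : Tendsto (fun z => |f z / G z - barF f z / G z| - ε * (f z / G z)) atTop (𝓝 (|1 - 1| - ε * 1)) :=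
    (hlim.sub h1).abs.sub (hlim.const_mul ε)
  have h3 := (tendsto_order.1 h2).2 0 (by simpa using hε)
  obtain ⟨Z, hZ⟩ := eventually_atTop.1 (h3.and (eventually_ge_atTop X))
  refine ⟨Real.exp (Real.exp Z), (Real.exp_pos _).le, fun z => ?_⟩
  rcases le_total Z z with h | h
  · obtain ⟨h4, h5⟩ := hZ z h
    have hGz := hG z h5
    rw [← sub_div, abs_div, abs_of_pos hGz, mul_div_assoc', ← sub_div, div_lt_iff₀ hGz, zero_mul] at h4
    have := mul_nonneg (Real.exp_pos (Real.exp Z)).le (kk_pos z).le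
    linarith
  · have h6 : Real.exp z ≤ Real.exp (Real.exp Z) * kk z := by
      unfold kk
      rw [← Real.exp_add]
      refine Real.exp_le_exp.2 ?_
      have := Real.exp_le_exp.2 h
      linarith
    have h7 : |f z - barF f z| ≤ Real.exp z := by
      have := hf0 z
      have := hf1 z
      have := barF_nonneg f hf0 z
      have := barF_le f hf hf0 hf1 z
      rw [abs_le]; constructor <;> linarith
    have := mul_nonneg hε.le (hf0 z)
    linarith

theorem conv_lim (hs : Summable fun i => Real.exp (-a i)) (ha : ∀ i, 0 ≤ a i)
    (f g G : ℝ → ℝ) (hf : Measurable f) (hf0 : ∀ z, 0 ≤ f z)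
    (C X α β : ℝ) (hg : ∀ x ≥ X, 0 < g x) (hG : ∀ x ≥ X, 0 < G x)
    (hfG : ∀ x ≥ X, ∀ z, 0 ≤ z → z ≤ x → f z ≤ C * G x)
    (hDg : ∀ x ≥ X, ∀ z ≤ x, UU a z - UU a (z - 1) ≤ C * g x)
    (hlim : Tendsto (fun x => f x / G x) atTop (𝓝 1))
    (hDlim : Tendsto (fun x => (UU a x - UU a (x - 1)) / g x) atTop (𝓝 1))
    (hGr : ∀ c > 0, Tendsto (fun x => G (c * x) / G x) atTop (𝓝 (c ^ α)))
    (hgr : ∀ c > 0, Tendsto (fun x => g (c * x) / g x) atTop (𝓝 (c ^ β))) :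
    Tendsto (fun x => (∫ y, FF f (x - y) * (UU a y - UU a (y - 1))) / (x * G x * g x)) atTop
      (𝓝 (∫ s in Set.Ioo (0:ℝ) 1, (1 - s) ^ α * s ^ β)) := by
  have hm := (UU_mono a hs).measurable
  have hFm := FF_meas f hf
  have hD0 : ∀ z, 0 ≤ UU a z - UU a (z - 1) := fun z =>
    sub_nonneg.2 (UU_mono a hs (by linarith))
  have hDn : ∀ z < 0, UU a z - UU a (z - 1) = 0 := fun z hz => by
    rw [UU_neg a ha z hz, UU_neg a ha _ (by linarith), sub_zero]
  rw [← integral_indicator measurableSet_Ioo]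
  have hmain : Tendsto (fun x => ∫ s, (FF f (x - x * s) / G x) *
      ((UU a (x * s) - UU a (x * s - 1)) / g x)) atTop
      (𝓝 (∫ s, (Set.Ioo (0:ℝ) 1).indicator (fun s => (1 - s) ^ α * s ^ β) s)) := by
    refine tendsto_integral_filter_of_dominated_convergence
      ((Set.Icc (0:ℝ) 1).indicator fun _ => |C| * |C|) ?_ ?_ ?_ ?_
    · refine Eventually.of_forall fun x => Measurable.aestronglyMeasurable ?_
      fun_prop
    · filter_upwards [eventually_ge_atTop X, eventually_gt_atTop 0] with x hx hx0
      refine Eventually.of_forall fun s => ?_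
      have hGx := hG x hx
      have hgx := hg x hx
      rw [Real.norm_of_nonneg (mul_nonneg (div_nonneg (FF_nonneg f hf0 _) hGx.le)
        (div_nonneg (hD0 _) hgx.le))]
      by_cases h1 : s < 0
      · rw [hDn _ (mul_neg_of_pos_of_neg hx0 h1), zero_div, mul_zero]
        exact Set.indicator_nonneg (fun _ _ => by positivity) _
      by_cases h2 : 1 < s
      · have : FF f (x - x * s) = 0 := by
          unfold FF
          rw [if_neg]
          nlinarith
        rw [this, zero_div, zero_mul]
        exact Set.indicator_nonneg (fun _ _ => by positivity) _
      push Not at h1 h2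
      rw [Set.indicator_of_mem (Set.mem_Icc.2 ⟨h1, h2⟩)]
      refine mul_le_mul ?_ ?_ (div_nonneg (hD0 _) hgx.le) (abs_nonneg _)
      · have h3 : 0 ≤ x - x * s := by nlinarith
        unfold FF
        rw [if_pos h3, div_le_iff₀ hGx]
        refine (hfG x hx _ h3 (by nlinarith)).trans ?_
        gcongr
        exact le_abs_self C
      · rw [div_le_iff₀ hgx]
        refine (hDg x hx _ (by nlinarith)).trans ?_
        gcongr
        exact le_abs_self C
    · exact (integrable_indicator_iff measurableSet_Icc).2 (integrableOn_const (by simp))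
    · have h01 : ∀ᵐ s : ℝ, s ≠ 0 ∧ s ≠ 1 := by
        refine (Measure.ae_ne _ _).and (Measure.ae_ne _ _)
      filter_upwards [h01] with s hs01
      by_cases h1 : s < 0
      · rw [Set.indicator_of_notMem (by simp only [Set.mem_Ioo]; intro h; linarith [h.1])]
        refine tendsto_const_nhds.congr' ?_
        filter_upwards [eventually_gt_atTop 0] with x hx0
        rw [hDn _ (mul_neg_of_pos_of_neg hx0 h1), zero_div, mul_zero]
      by_cases h2 : 1 < s
      · rw [Set.indicator_of_notMem (by simp only [Set.mem_Ioo]; intro h; linarith [h.2])]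
        refine tendsto_const_nhds.congr' ?_
        filter_upwards [eventually_gt_atTop 0] with x hx0
        have : FF f (x - x * s) = 0 := by
          unfold FF
          rw [if_neg]
          nlinarith
        rw [this, zero_div, zero_mul]
      push Not at h1 h2
      have hs0 : 0 < s := lt_of_le_of_ne h1 (Ne.symm hs01.1)
      have hs1 : s < 1 := lt_of_le_of_ne h2 hs01.2
      rw [Set.indicator_of_mem (Set.mem_Ioo.2 ⟨hs0, hs1⟩)]
      have hs1' : 0 < 1 - s := by linarith
      have t1 : Tendsto (fun x : ℝ => s * x) atTop atTop := tendsto_id.const_mul_atTop hs0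
      have t2 : Tendsto (fun x : ℝ => (1 - s) * x) atTop atTop := tendsto_id.const_mul_atTop hs1'
      refine Tendsto.mul ?_ ?_
      · have h3 := (hlim.comp t2).mul (hGr _ hs1')
        rw [one_mul] at h3
        refine h3.congr' ?_
        filter_upwards [t2.eventually (eventually_ge_atTop X), t2.eventually (eventually_ge_atTop 0)]
          with x hx hx0
        have := hG _ hx
        have e : x - x * s = (1 - s) * x := by ring
        simp only [Function.comp, FF]
        rw [e, if_pos hx0]
        field_simp
      · have h3 := (hDlim.comp t1).mul (hgr _ hs0)
        rw [one_mul] at h3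
        refine h3.congr' ?_
        filter_upwards [t1.eventually (eventually_ge_atTop X)] with x hx
        have := hg _ hx
        simp only [Function.comp]
        rw [mul_comm x s]
        field_simp
  refine hmain.congr' ?_
  filter_upwards [eventually_ge_atTop X, eventually_gt_atTop 0] with x hx hx0
  have hGx := hG x hx
  have hgx := hg x hx
  have e := Measure.integral_comp_mul_left
    (fun y => (FF f (x - y) / G x) * ((UU a y - UU a (y - 1)) / g x)) x
  rw [e, smul_eq_mul, abs_of_pos (by positivity)]
  have e2 : ∀ y, (FF f (x - y) / G x) * ((UU a y - UU a (y - 1)) / g x) =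
      (FF f (x - y) * (UU a y - UU a (y - 1))) / (G x * g x) := by
    intro y
    field_simp
  simp only [e2]
  rw [integral_div]
  field_simp

theorem final_squeeze (A I E N : ℝ → ℝ) (B : ℝ) (hN : ∀ᶠ x in atTop, 0 < N x)
    (hA : ∀ x, 0 ≤ A x)
    (hI : Tendsto (fun x => I x / N x) atTop (𝓝 B))
    (hE : Tendsto (fun x => E x / N x) atTop (𝓝 0))
    (hcmp : ∀ ε > 0, ∃ K ≥ 0, ∀ x, |A x - I x| ≤ ε * A x + K * E x) :
    Tendsto (fun x => A x / N x) atTop (𝓝 B) := by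
  rw [Metric.tendsto_atTop']
  intro δ hδ
  set ε := min (1/2) (δ / (8 * (|B| + 2))) with hε
  have hε0 : 0 < ε := by positivity
  have hε1 : ε ≤ 1/2 := min_le_left _ _
  have hε2 : ε * (|B| + 2) ≤ δ / 8 := by
    calc ε * (|B| + 2) ≤ δ / (8 * (|B| + 2)) * (|B| + 2) := by
          gcongr
          exact min_le_right _ _
      _ = δ / 8 := by field_simp
  obtain ⟨K, hK, hc⟩ := hcmp ε hε0
  have h1 : ∀ᶠ x in atTop, K * (E x / N x) < min 1 (δ/4) := by
    have := hE.const_mul K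
    rw [mul_zero] at this
    exact (tendsto_order.1 this).2 _ (by positivity)
  have h2 : ∀ᶠ x in atTop, |I x / N x - B| < min 1 (δ/4) := by
    have := Metric.tendsto_nhds.1 hI (min 1 (δ/4)) (by positivity)
    simpa [Real.dist_eq] using this
  obtain ⟨T, hT⟩ := eventually_atTop.1 (hN.and (h1.and h2))
  refine ⟨T, fun x hx => ?_⟩
  obtain ⟨n, e, q⟩ := hT x hx.le
  rw [Real.dist_eq]
  have h3 : |A x / N x - I x / N x| ≤ ε * (A x / N x) + K * (E x / N x) := by
    rw [← sub_div, abs_div, abs_of_pos n, div_le_iff₀ n]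
    refine (hc x).trans (le_of_eq ?_)
    field_simp
  have hr : 0 ≤ A x / N x := div_nonneg (hA x) n.le
  generalize A x / N x = r at *
  generalize I x / N x = i at *
  generalize K * (E x / N x) = w at *
  have e1 := min_le_left 1 (δ/4)
  have e2 := min_le_right 1 (δ/4)
  have hB := le_abs_self B
  obtain ⟨q1, q2⟩ := abs_lt.1 q
  obtain ⟨p1, p2⟩ := abs_le.1 h3
  have h4 : r ≤ 2 * (|B| + 2) := by nlinarith
  have h5 : ε * r ≤ δ / 4 := by nlinarith
  rw [abs_lt]; constructor <;> linarith

theorem step_lim [Countable ι] (hs : Summable fun i => Real.exp (-a i)) (ha : ∀ i, 0 ≤ a i)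
    (f g G : ℝ → ℝ) (hf : Measurable f) (hf0 : ∀ z, 0 ≤ f z) (hf1 : ∀ z, f z ≤ Real.exp z)
    (C X α β : ℝ) (hg : ∀ x ≥ X, 0 < g x) (hG : ∀ x ≥ X, 0 < G x)
    (hfG : ∀ x ≥ X, ∀ z, 0 ≤ z → z ≤ x → f z ≤ C * G x)
    (hDg : ∀ x ≥ X, ∀ z ≤ x, UU a z - UU a (z - 1) ≤ C * g x)
    (hlim : Tendsto (fun x => f x / G x) atTop (𝓝 1))
    (hDlim : Tendsto (fun x => (UU a x - UU a (x - 1)) / g x) atTop (𝓝 1))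
    (hGr : ∀ c > 0, Tendsto (fun x => G (c * x) / G x) atTop (𝓝 (c ^ α)))
    (hgr : ∀ c > 0, Tendsto (fun x => g (c * x) / g x) atTop (𝓝 (c ^ β)))
    (hsh : ∀ u, Tendsto (fun x => G (x - u) / G x) atTop (𝓝 1))
    (hbase : Tendsto (fun x => (∑' i, kk (x - a i)) / g x) atTop (𝓝 1))
    (hxG : Tendsto (fun x => x * G x) atTop atTop) :
    Tendsto (fun x => (∑' i, f (x - a i)) / (x * G x * g x)) atTop
      (𝓝 (∫ s in Set.Ioo (0:ℝ) 1, (1 - s) ^ α * s ^ β)) := by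
  have hsum : ∀ (F : ℝ → ℝ), (∀ z, 0 ≤ F z) → (∀ z, F z ≤ Real.exp z) → ∀ x,
      Summable fun i => F (x - a i) := by
    intro F h0 h1 x
    refine Summable.of_nonneg_of_le (fun i => h0 _) (fun i => ?_) (hs.mul_left (Real.exp x))
    rw [← Real.exp_add, ← sub_eq_add_neg]
    exact h1 _
  have sA := hsum f hf0 hf1
  have sI := hsum (barF f) (barF_nonneg f hf0) (barF_le f hf hf0 hf1)
  have sK := hsum kk (fun z => (kk_pos z).le) kk_le
  refine final_squeeze _ (fun x => ∑' i, barF f (x - a i)) (fun x => ∑' i, kk (x - a i)) _ _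
    ?_ (fun x => tsum_nonneg fun i => hf0 _) ?_ ?_ ?_
  · filter_upwards [eventually_ge_atTop X, eventually_gt_atTop 0] with x hx hx0
    exact mul_pos (mul_pos hx0 (hG x hx)) (hg x hx)
  · simp only [barF_tsum a hs f hf hf0 hf1]
    exact conv_lim a hs ha f g G hf hf0 C X α β hg hG hfG hDg hlim hDlim hGr hgr
  · have := hbase.mul hxG.inv_tendsto_atTop
    rw [mul_zero] at this
    refine this.congr fun x => ?_
    simp only [Pi.inv_apply]
    rw [div_eq_mul_inv, div_eq_mul_inv, mul_inv (x * G x)]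
    ring
  · intro ε hε
    obtain ⟨K, hK, hc⟩ := compare_aux f G hf hf0 hf1 C X hG hfG hlim hsh ε hε
    refine ⟨K, hK, fun x => ?_⟩
    rw [← (sA x).tsum_sub (sI x), ← tsum_mul_left, ← tsum_mul_left,
      ← ((sA x).mul_left ε).tsum_add ((sK x).mul_left K), ← Real.norm_eq_abs]
    refine tsum_of_norm_bounded (((sA x).mul_left ε).add ((sK x).mul_left K)).hasSum fun i => ?_
    exact hc _

end

theorem beta_real (α β : ℝ) (hα : 0 ≤ α) (hβ : 0 ≤ β) :
    ∫ s in Set.Ioo (0:ℝ) 1, (1 - s) ^ α * s ^ β =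
      Real.Gamma (α + 1) * Real.Gamma (β + 1) / Real.Gamma (α + 1 + (β + 1)) := by
  have h := ProbabilityTheory.beta_eq_betaIntegralReal (β + 1) (α + 1) (by linarith) (by linarith)
  unfold ProbabilityTheory.beta at h
  have e : Real.Gamma (α + 1) * Real.Gamma (β + 1) / Real.Gamma (α + 1 + (β + 1)) =
      Real.Gamma (β + 1) * Real.Gamma (α + 1) / Real.Gamma (β + 1 + (α + 1)) := by
    rw [mul_comm, add_comm (α + 1)]
  rw [e, h, Complex.betaIntegral]
  have e2 : (∫ x in (0:ℝ)..1, (x:ℂ) ^ (((β + 1 : ℝ) : ℂ) - 1) * (1 - (x:ℂ)) ^ (((α + 1 : ℝ) : ℂ) - 1)) =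
      ∫ x in (0:ℝ)..1, (((1 - x) ^ α * x ^ β : ℝ) : ℂ) := by
    refine intervalIntegral.integral_congr fun x hx => ?_
    rw [Set.uIcc_of_le zero_le_one] at hx
    push_cast
    rw [Complex.ofReal_cpow (by linarith [hx.2]), Complex.ofReal_cpow hx.1]
    push_cast
    rw [add_sub_cancel_right, add_sub_cancel_right, mul_comm]
  rw [e2, intervalIntegral.integral_ofReal, Complex.ofReal_re,
    intervalIntegral.integral_of_le zero_le_one, integral_Ioc_eq_integral_Ioo]

section
variable (p : ℕ → ℝ)

theorem prodP_nonneg (hp0 : ∀ k, 0 ≤ p k) (j : ℕ) (r : Fin j → ℕ) : 0 ≤ prodP p j r :=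
  Finset.prod_nonneg fun i _ => hp0 _

theorem prodP_cons (j : ℕ) (k : ℕ) (r : Fin j → ℕ) :
    prodP p (j+1) (Fin.cons k r : Fin (j+1) → ℕ) = p k * prodP p j r := by
  unfold prodP
  rw [Fin.prod_univ_succ]
  simp

theorem prodP_hasSum (hp0 : ∀ k, 0 ≤ p k) (hp : HasSum p 1) (j : ℕ) : HasSum (prodP p j) 1 := by
  induction j with
  | zero =>
    have : prodP p 0 = fun _ => 1 := by
      funext r
      simp [prodP]
    rw [this]
    have h := hasSum_unique (fun _ : Fin 0 → ℕ => (1:ℝ))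
    exact h
  | succ j ih =>
    rw [← (Fin.consEquiv (fun _ : Fin (j+1) => ℕ)).hasSum_iff]
    have h1 : Summable fun x : ℕ × (Fin j → ℕ) => p x.1 * prodP p j x.2 :=
      hp.summable.mul_of_nonneg ih.summable hp0 (prodP_nonneg p hp0 j)
    have h2 := hp.mul ih h1
    rw [one_mul] at h2
    refine h2.congr_fun ?_
    intro x
    exact (prodP_cons p j x.1 x.2)

theorem Phi_term_le (hp0 : ∀ k, 0 ≤ p k) (j : ℕ) (t : ℝ) (ht : 0 ≤ t) (r : Fin j → ℕ) :
    prodP p j r * Real.exp (-t * prodP p j r) ≤ prodP p j r := by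
  have h := prodP_nonneg p hp0 j r
  refine mul_le_of_le_one_right h (Real.exp_le_one_iff.2 ?_)
  nlinarith

theorem Phi_summable (hp0 : ∀ k, 0 ≤ p k) (hp : HasSum p 1) (j : ℕ) (t : ℝ) (ht : 0 ≤ t) :
    Summable fun r : Fin j → ℕ => prodP p j r * Real.exp (-t * prodP p j r) :=
  Summable.of_nonneg_of_le (fun r => mul_nonneg (prodP_nonneg p hp0 j r) (Real.exp_pos _).le)
    (Phi_term_le p hp0 j t ht) (prodP_hasSum p hp0 hp j).summable

theorem Phi_nonneg (hp0 : ∀ k, 0 ≤ p k) (j : ℕ) (t : ℝ) : 0 ≤ PhiJDeriv p j t :=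
  tsum_nonneg fun r => mul_nonneg (prodP_nonneg p hp0 j r) (Real.exp_pos _).le

theorem Phi_le_one (hp0 : ∀ k, 0 ≤ p k) (hp : HasSum p 1) (j : ℕ) (t : ℝ) (ht : 0 ≤ t) :
    PhiJDeriv p j t ≤ 1 := by
  rw [← (prodP_hasSum p hp0 hp j).tsum_eq]
  exact (Phi_summable p hp0 hp j t ht).tsum_le_tsum (Phi_term_le p hp0 j t ht)
    (prodP_hasSum p hp0 hp j).summable

theorem Phi_anti (hp0 : ∀ k, 0 ≤ p k) (hp : HasSum p 1) (j : ℕ) (s t : ℝ) (hs : 0 ≤ s)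
    (hst : s ≤ t) : PhiJDeriv p j t ≤ PhiJDeriv p j s := by
  refine (Phi_summable p hp0 hp j t (hs.trans hst)).tsum_le_tsum (fun r => ?_)
    (Phi_summable p hp0 hp j s hs)
  have h := prodP_nonneg p hp0 j r
  gcongr

theorem Phi_succ (hp0 : ∀ k, 0 ≤ p k) (hp : HasSum p 1) (j : ℕ) (t : ℝ) (ht : 0 ≤ t) :
    PhiJDeriv p (j+1) t = ∑' k, p k * PhiJDeriv p j (t * p k) := by
  unfold PhiJDeriv
  have hS := Phi_summable p hp0 hp (j+1) t ht
  rw [← (Fin.consEquiv (fun _ : Fin (j+1) => ℕ)).tsum_eq]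
  rw [← (Fin.consEquiv (fun _ : Fin (j+1) => ℕ)).summable_iff] at hS
  have hS' : Summable fun x : ℕ × (Fin j → ℕ) =>
      prodP p (j+1) ((Fin.consEquiv (fun _ : Fin (j+1) => ℕ)) x) *
        Real.exp (-t * prodP p (j+1) ((Fin.consEquiv (fun _ : Fin (j+1) => ℕ)) x)) := hS
  rw [hS'.tsum_prod]
  refine tsum_congr fun k => ?_
  rw [← tsum_mul_left]
  refine tsum_congr fun r => ?_
  have : prodP p (j+1) ((Fin.consEquiv (fun _ : Fin (j+1) => ℕ)) (k, r)) = p k * prodP p j r :=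
    prodP_cons p j k r
  rw [this, mul_assoc]
  congr 3
  ring

/-- `f_j(x) = e^x Φ_j'(e^x)`. -/
noncomputable def fJ (j : ℕ) (x : ℝ) : ℝ := Real.exp x * PhiJDeriv p j (Real.exp x)

theorem fJ_zero (x : ℝ) : fJ p 0 x = kk x := by
  unfold fJ PhiJDeriv kk
  rw [tsum_eq_single (default : Fin 0 → ℕ) (fun r hr => absurd (Subsingleton.elim _ _) hr)]
  simp [prodP, Real.exp_sub, Real.exp_neg, div_eq_mul_inv]

theorem fJ_nonneg (hp0 : ∀ k, 0 ≤ p k) (j : ℕ) (x : ℝ) : 0 ≤ fJ p j x :=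
  mul_nonneg (Real.exp_pos x).le (Phi_nonneg p hp0 j _)

theorem fJ_le (hp0 : ∀ k, 0 ≤ p k) (hp : HasSum p 1) (j : ℕ) (x : ℝ) : fJ p j x ≤ Real.exp x :=
  mul_le_of_le_one_right (Real.exp_pos x).le (Phi_le_one p hp0 hp j _ (Real.exp_pos x).le)

theorem fJ_meas (hp0 : ∀ k, 0 ≤ p k) (hp : HasSum p 1) (j : ℕ) : Measurable (fJ p j) := by
  have h : Antitone fun x => PhiJDeriv p j (Real.exp x) := fun x y hxy =>
    Phi_anti p hp0 hp j _ _ (Real.exp_pos x).le (Real.exp_le_exp.2 hxy)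
  exact Real.measurable_exp.mul h.measurable

/-- The family `a_k = -log p_k`, over the support of `p`. -/
noncomputable def aP (i : {k // 0 < p k}) : ℝ := -Real.log (p i)

theorem fJ_succ (hp0 : ∀ k, 0 ≤ p k) (hp : HasSum p 1) (j : ℕ) (x : ℝ) :
    fJ p (j+1) x = ∑' i, fJ p j (x - aP p i) := by
  have h1 : fJ p (j+1) x = ∑' k, Real.exp x * (p k * PhiJDeriv p j (Real.exp x * p k)) := by
    unfold fJ
    rw [Phi_succ p hp0 hp j _ (Real.exp_pos x).le, tsum_mul_left]
  rw [h1, ← tsum_subtype_eq_of_support_subset (s := {k | 0 < p k})]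
  · refine tsum_congr fun i => ?_
    have hi : 0 < p i := i.2
    have e : Real.exp (x - aP p i) = Real.exp x * p i := by
      unfold aP
      rw [sub_neg_eq_add, Real.exp_add, Real.exp_log hi]
    unfold fJ
    rw [e]
    ring
  · intro k hk
    rw [Function.mem_support] at hk
    show 0 < p k
    refine lt_of_le_of_ne (hp0 k) fun h => hk ?_
    rw [← h]; ring

theorem aP_nonneg (hp0 : ∀ k, 0 ≤ p k) (hp : HasSum p 1) (i) : 0 ≤ aP p i := by
  unfold aP
  have : p i ≤ 1 := le_hasSum hp i fun k _ => hp0 k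
  have := Real.log_nonpos (hp0 i) this
  linarith

theorem aP_summable (hp : HasSum p 1) : Summable fun i => Real.exp (-aP p i) := by
  have : (fun i => Real.exp (-aP p i)) = fun i : {k // 0 < p k} => p i := by
    funext i
    unfold aP
    rw [neg_neg, Real.exp_log i.2]
  rw [this]
  exact hp.summable.subtype {k | 0 < p k}

theorem rho_eq (hp : HasSum p 1) (x : ℝ) : rhoJ p 1 (Real.exp x) = UU (aP p) x := by
  rw [UU_card _ (aP_summable p hp)]
  unfold rhoJ
  congr 1
  have hpos : ∀ k, 1 / Real.exp x ≤ p k → 0 < p k := fun k h =>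
    lt_of_lt_of_le (by positivity) h
  have hiff : ∀ i : {k // 0 < p k}, aP p i ≤ x ↔ 1 / Real.exp x ≤ p i := by
    intro i
    unfold aP
    rw [one_div, ← Real.exp_neg, ← Real.le_log_iff_exp_le i.2]
    constructor <;> intro <;> linarith
  have hprod : ∀ r : Fin 1 → ℕ, prodP p 1 r = p (r 0) := by
    intro r
    simp [prodP]
  refine Nat.card_congr ⟨fun r => ⟨⟨r.1 0, hpos _ (by rw [← hprod]; exact r.2)⟩,
    (hiff _).2 (by rw [← hprod]; exact r.2)⟩,
    fun i => ⟨fun _ => i.1.1, by rw [hprod]; exact (hiff _).1 i.2⟩, ?_, ?_⟩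
  · intro r
    apply Subtype.ext
    funext k
    rw [Subsingleton.elim k 0]
  · intro i
    rfl

end

/-- Domination: if `h ~ G` with `G` almost increasing, then `h z ≤ C G x` for `z ≤ x`, `x` large. -/
theorem dom_all (h G : ℝ → ℝ) (hb : ∀ Y, ∃ M, ∀ z ≤ Y, h z ≤ M) (hG : ∀ x > 0, 0 < G x)
    (hai : ∃ C > 0, ∃ X > 0, ∀ z x, X ≤ z → z ≤ x → G z ≤ C * G x)
    (hlim : Tendsto (fun x => h x / G x) atTop (𝓝 1)) :
    ∃ C > 0, ∃ X > 0, ∀ x ≥ X, ∀ z ≤ x, h z ≤ C * G x := by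
  obtain ⟨C, hC, X, hX, hai⟩ := hai
  obtain ⟨Y, hY⟩ := eventually_atTop.1 ((tendsto_order.1 hlim).2 2 (by norm_num))
  set Z := max X Y with hZ
  have hZ0 : 0 < Z := lt_of_lt_of_le hX (le_max_left _ _)
  obtain ⟨M, hM⟩ := hb Z
  have hGZ := hG Z hZ0
  refine ⟨max (2 * C) (|M| * C / G Z), by positivity, Z, hZ0, fun x hx z hz => ?_⟩
  have hGx := hG x (by linarith)
  rcases le_total z Z with h1 | h1
  · have h2 := hai Z x (le_max_left _ _) hx
    calc h z ≤ |M| := (hM z h1).trans (le_abs_self M)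
      _ = |M| * G Z / G Z := by field_simp
      _ ≤ |M| * (C * G x) / G Z := by gcongr
      _ = (|M| * C / G Z) * G x := by ring
      _ ≤ _ := by gcongr; exact le_max_right _ _
  · have h2 := hai z x ((le_max_left _ _).trans h1) hz
    have h3 := hY z ((le_max_right _ _).trans h1)
    have hGz := hG z (by linarith)
    rw [div_lt_iff₀ hGz] at h3
    calc h z ≤ 2 * (C * G x) := by linarith
      _ = (2 * C) * G x := by ring
      _ ≤ _ := by gcongr; exact le_max_left _ _

/-- The normalising constant and function of generation `n+1`. -/
noncomputable def cN (β : ℝ) (n : ℕ) : ℝ :=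
  Real.Gamma (β + 1) ^ (n+1) / Real.Gamma ((n+1) * (β + 1))

noncomputable def GN (β : ℝ) (g : ℝ → ℝ) (n : ℕ) (x : ℝ) : ℝ := cN β n * (x ^ n * g x ^ (n+1))

theorem cN_pos (β : ℝ) (hβ : 0 ≤ β) (n : ℕ) : 0 < cN β n := by
  unfold cN
  have h1 := Real.Gamma_pos_of_pos (by linarith : 0 < β + 1)
  have h2 := Real.Gamma_pos_of_pos (by positivity : 0 < ((n:ℝ)+1) * (β + 1))
  positivity

theorem GN_lim (p : ℕ → ℝ) (hp0 : ∀ k, 0 ≤ p k) (hp : HasSum p 1) (β : ℝ) (hβ : 0 ≤ β)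
    (g : ℝ → ℝ) (hg : ∀ x > 0, 0 < g x)
    (hU : ∀ h, Tendsto (fun x => (UU (aP p) (x + h) - UU (aP p) x) / g x) atTop (𝓝 h))
    (hgr : ∀ c > 0, Tendsto (fun x => g (c * x) / g x) atTop (𝓝 (c ^ β)))
    (hai : ∃ C > 0, ∃ X > 0, ∀ z x, X ≤ z → z ≤ x → g z ≤ C * g x) (n : ℕ) :
    Tendsto (fun x => fJ p (n+1) x / GN β g n x) atTop (𝓝 1) := by
  have hs := aP_summable p hp
  have ha := aP_nonneg p hp0 hp
  have hm := UU_mono (aP p) hs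
  have hDlim : Tendsto (fun x => (UU (aP p) x - UU (aP p) (x - 1)) / g x) atTop (𝓝 1) := by
    have := (hU (-1)).neg
    rw [neg_neg] at this
    refine this.congr fun x => ?_
    rw [← sub_eq_add_neg]
    ring
  have hsh : ∀ h, Tendsto (fun x => g (x + h) / g x) atTop (𝓝 1) := by
    intro h
    have h1 : Tendsto (fun x => (UU (aP p) (x + h + 1) - UU (aP p) (x + h)) / g x) atTop (𝓝 1) := by
      have := (hU (h + 1)).sub (hU h)
      rw [add_sub_cancel_left] at this
      refine this.congr fun x => ?_
      rw [← add_assoc]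
      ring
    have ht : Tendsto (fun x : ℝ => x + h) atTop atTop := tendsto_atTop_add_const_right _ h tendsto_id
    have h2 := (hU 1).comp ht
    have h3 := h1.div h2 one_ne_zero
    rw [div_one] at h3
    refine h3.congr' ?_
    filter_upwards [eventually_gt_atTop 0, ht.eventually (eventually_gt_atTop 0),
      (tendsto_order.1 h2).1 0 one_pos] with x hx hx2 hx3
    have e1 := hg _ hx
    have e2 := hg _ hx2
    simp only [Function.comp] at hx3
    have e3 : 0 < UU (aP p) (x + h + 1) - UU (aP p) (x + h) := by
      by_contra hc
      push Not at hc
      exact absurd (div_nonpos_of_nonpos_of_nonneg hc e2.le) (not_le.2 hx3)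
    simp only [Function.comp, Pi.div_apply]
    field_simp
  obtain ⟨C1, hC1, X1, hX1, hDg⟩ := dom_all (fun z => UU (aP p) z - UU (aP p) (z - 1)) g
    (fun Y => ⟨UU (aP p) Y, fun z hz => by
      have := hm hz
      have := UU_nonneg (aP p) (z - 1)
      linarith⟩) hg hai hDlim
  have hbase : Tendsto (fun x => (∑' i, kk (x - aP p i)) / g x) atTop (𝓝 1) := by
    have he : (1:ℝ) < Real.exp (1/2) := Real.one_lt_exp_iff.2 (by norm_num)
    obtain ⟨X2, hX2⟩ := eventually_atTop.1 ((tendsto_order.1 (hsh 1)).2 _ he)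
    refine base_lim (aP p) hs g C1 (max X1 X2) hC1 (fun x hx => hg x ?_) (fun x hx => hDg x ?_)
      (fun x hx => ?_) hU
    · exact lt_of_lt_of_le hX1 ((le_max_left _ _).trans hx)
    · exact (le_max_left _ _).trans hx
    · have h1 := hX2 x ((le_max_right _ _).trans hx)
      rw [div_lt_iff₀ (hg x (lt_of_lt_of_le hX1 ((le_max_left _ _).trans hx)))] at h1
      exact h1.le
  have hf1 : ∀ x, fJ p 1 x = ∑' i, kk (x - aP p i) := by
    intro x
    rw [show (1:ℕ) = 0 + 1 from rfl, fJ_succ p hp0 hp]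
    simp only [fJ_zero]
  induction n with
  | zero =>
    refine hbase.congr fun x => ?_
    rw [zero_add, hf1]
    have : cN β 0 = 1 := by
      unfold cN
      have h1 := (Real.Gamma_pos_of_pos (by linarith : 0 < β + 1)).ne'
      simp [h1]
    simp [GN, this]
  | succ n ih =>
    have hc := cN_pos β hβ n
    have hGpos : ∀ x > 0, 0 < GN β g n x := fun x hx => by
      have := hg x hx
      unfold GN
      positivity
    have hGai : ∃ C > 0, ∃ X > 0, ∀ z x, X ≤ z → z ≤ x → GN β g n z ≤ C * GN β g n x := by
      obtain ⟨C, hC, X, hX, h⟩ := hai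
      refine ⟨C ^ (n+1), by positivity, X, hX, fun z x hz hzx => ?_⟩
      have h1 := h z x hz hzx
      have h2 := hg z (by linarith)
      have h3 := hg x (by linarith)
      unfold GN
      calc cN β n * (z ^ n * g z ^ (n+1)) ≤ cN β n * (x ^ n * (C * g x) ^ (n+1)) := by
            have : 0 ≤ z := by linarith
            have : 0 ≤ x := by linarith
            gcongr
        _ = _ := by rw [mul_pow]; ring
    obtain ⟨C2, hC2, X2, hX2, hfG⟩ := dom_all (fJ p (n+1)) (GN β g n)
      (fun Y => ⟨Real.exp Y, fun z hz => (fJ_le p hp0 hp _ z).trans (Real.exp_le_exp.2 hz)⟩)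
      hGpos hGai ih
    set α : ℝ := (n + 1) * (β + 1) - 1 with hα
    have hα0 : 0 ≤ α := by
      have : (0:ℝ) ≤ n := n.cast_nonneg
      nlinarith
    have hGr : ∀ c > 0, Tendsto (fun x => GN β g n (c * x) / GN β g n x) atTop (𝓝 (c ^ α)) := by
      intro c hc0
      have h1 := ((hgr c hc0).pow (n+1)).const_mul (c ^ n)
      have e : c ^ n * (c ^ β) ^ (n+1) = c ^ α := by
        rw [← Real.rpow_natCast c n, ← Real.rpow_natCast (c ^ β) (n+1), ← Real.rpow_mul hc0.le,
          ← Real.rpow_add hc0]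
        congr 1
        push_cast
        rw [hα]; ring
      rw [e] at h1
      refine h1.congr' ?_
      filter_upwards [eventually_gt_atTop 0] with x hx
      have := hg x hx
      unfold GN
      rw [mul_pow, div_pow]
      field_simp
    have hGsh : ∀ u, Tendsto (fun x => GN β g n (x - u) / GN β g n x) atTop (𝓝 1) := by
      intro u
      have h1 : Tendsto (fun x : ℝ => (x - u) / x) atTop (𝓝 1) := by
        have h2 : Tendsto (fun x : ℝ => 1 - u * x⁻¹) atTop (𝓝 (1 - u * 0)) :=
          tendsto_const_nhds.sub (tendsto_inv_atTop_zero.const_mul u)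
        rw [mul_zero, sub_zero] at h2
        refine h2.congr' ?_
        filter_upwards [eventually_gt_atTop 0] with x hx
        field_simp
      have h3 := (h1.pow n).mul ((hsh (-u)).pow (n+1))
      simp only [one_pow, one_mul] at h3
      refine h3.congr' ?_
      filter_upwards [eventually_gt_atTop 0] with x hx
      have := hg x hx
      unfold GN
      rw [div_pow, div_pow, ← sub_eq_add_neg]
      field_simp
    have hxG : Tendsto (fun x => x * GN β g n x) atTop atTop := by
      obtain ⟨C, hC, X, hX, h⟩ := hai
      have hgX := hg X hX
      have h1 : Tendsto (fun x : ℝ => (cN β n * (g X / C) ^ (n+1)) * x ^ (n+1)) atTop atTop :=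
        (tendsto_pow_atTop n.succ_ne_zero).const_mul_atTop (by positivity)
      refine tendsto_atTop_mono' _ ?_ h1
      filter_upwards [eventually_ge_atTop X] with x hx
      have h2 := h X x le_rfl hx
      have h3 : g X / C ≤ g x := by
        rw [div_le_iff₀ hC]; linarith
      have hx0 : 0 < x := by linarith
      calc (cN β n * (g X / C) ^ (n+1)) * x ^ (n+1) ≤ (cN β n * (g x) ^ (n+1)) * x ^ (n+1) := by
            gcongr
        _ = _ := by unfold GN; ring
    have hX12 : ∀ x ≥ max X1 X2, X1 ≤ x ∧ X2 ≤ x := fun x hx =>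
      ⟨(le_max_left _ _).trans hx, (le_max_right _ _).trans hx⟩
    have hstep := step_lim (aP p) hs ha (fJ p (n+1)) g (GN β g n) (fJ_meas p hp0 hp _)
      (fJ_nonneg p hp0 _) (fJ_le p hp0 hp _) (max C1 C2) (max X1 X2) α β
      (fun x hx => hg x (by linarith [(hX12 x hx).1]))
      (fun x hx => hGpos x (by linarith [(hX12 x hx).1]))
      (fun x hx z _ hz => (hfG x (hX12 x hx).2 z hz).trans (by
        have := hGpos x (by linarith [(hX12 x hx).1])
        gcongr
        exact le_max_right _ _))
      (fun x hx z hz => (hDg x (hX12 x hx).1 z hz).trans (by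
        have := hg x (by linarith [(hX12 x hx).1])
        gcongr
        exact le_max_left _ _))
      ih hDlim hGr hgr hGsh hbase hxG
    rw [beta_real α β hα0 hβ] at hstep
    have hA : Real.Gamma (α + 1) = Real.Gamma ((n+1) * (β+1)) := by rw [hα]; ring_nf
    have hB : Real.Gamma (α + 1 + (β + 1)) = Real.Gamma (((n+1:ℕ)+1) * (β+1)) := by
      rw [hα]; push_cast; ring_nf
    rw [hA, hB] at hstep
    have hc' := cN_pos β hβ (n+1)
    have g1 := Real.Gamma_pos_of_pos (by linarith : 0 < β + 1)
    have g2 := Real.Gamma_pos_of_pos (by positivity : 0 < ((n:ℝ)+1) * (β + 1))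
    have g3 := Real.Gamma_pos_of_pos (by positivity : 0 < (((n+1:ℕ):ℝ)+1) * (β + 1))
    have hfin := hstep.mul_const (cN β n / cN β (n+1))
    have hone : Real.Gamma ((n+1) * (β+1)) * Real.Gamma (β + 1) /
        Real.Gamma (((n+1:ℕ)+1) * (β+1)) * (cN β n / cN β (n+1)) = 1 := by
      unfold cN
      field_simp
      ring
    rw [hone] at hfin
    refine hfin.congr' ?_
    filter_upwards [eventually_gt_atTop 0] with x hx
    have := hg x hx
    rw [fJ_succ p hp0 hp (n+1) x]
    unfold GN
    field_simp
    ring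

theorem stmt3
    (p : ℕ → ℝ) (hp0 : ∀ k, 0 ≤ p k) (hp1 : ∑' k, p k = 1)
    (hpinf : {k | 0 < p k}.Infinite)
    (β : ℝ) (hβ : 0 ≤ β)
    (ℓ : ℝ → ℝ) (hℓpos : ∀ x > 0, 0 < ℓ x)
    (hℓsv : ∀ c > 0, Tendsto (fun x => ℓ (c * x) / ℓ x) atTop (𝓝 1))
    (h6 : ∀ lam > 0, Tendsto
      (fun t => (rhoJ p 1 (lam * t) - rhoJ p 1 t) / (Real.log t ^ β * ℓ (Real.log t)))
      atTop (𝓝 (Real.log lam)))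
    (h60 : β = 0 → (∃ x₀, MonotoneOn ℓ (Set.Ici x₀)) ∧ Tendsto ℓ atTop atTop)
    (j : ℕ) (hj : 1 ≤ j) :
    Tendsto
      (fun t => PhiJDeriv p j t /
        ((Real.Gamma (β + 1)) ^ j / Real.Gamma (j * (β + 1)) *
          (Real.log t ^ ((j : ℝ) * β + j - 1) * (ℓ (Real.log t)) ^ j / t)))
      atTop (𝓝 1) := by
  have hp : HasSum p 1 := by
    have hsum : Summable p := by
      by_contra h
      rw [tsum_eq_zero_of_not_summable h] at hp1
      exact zero_ne_one hp1
    rw [← hp1]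
    exact hsum.hasSum
  obtain ⟨n, rfl⟩ : ∃ n, j = n + 1 := ⟨j - 1, by omega⟩
  set g : ℝ → ℝ := fun x => x ^ β * ℓ x with hgdef
  have hg : ∀ x > 0, 0 < g x := fun x hx => mul_pos (Real.rpow_pos_of_pos hx _) (hℓpos x hx)
  have hs := aP_summable p hp
  have hm := UU_mono (aP p) hs
  have hU : ∀ h, Tendsto (fun x => (UU (aP p) (x + h) - UU (aP p) x) / g x) atTop (𝓝 h) := by
    intro h
    have h1 := (h6 (Real.exp h) (Real.exp_pos h)).comp Real.tendsto_exp_atTop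
    rw [Real.log_exp] at h1
    refine h1.congr fun x => ?_
    simp only [Function.comp, hgdef, Real.log_exp]
    rw [← Real.exp_add, rho_eq p hp, rho_eq p hp, add_comm h x]
  have hgr : ∀ c > 0, Tendsto (fun x => g (c * x) / g x) atTop (𝓝 (c ^ β)) := by
    intro c hc
    have h1 := (hℓsv c hc).const_mul (c ^ β)
    rw [mul_one] at h1
    refine h1.congr' ?_
    filter_upwards [eventually_gt_atTop 0] with x hx
    have h2 := Real.rpow_pos_of_pos hx β
    have h3 := hℓpos x hx
    simp only [hgdef]
    rw [Real.mul_rpow hc.le hx.le]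
    field_simp
  have hai : ∃ C > 0, ∃ X > 0, ∀ z x, X ≤ z → z ≤ x → g z ≤ C * g x := by
    rcases hβ.eq_or_lt with hb | hb
    · obtain ⟨⟨x₀, hx₀⟩, -⟩ := h60 hb.symm
      refine ⟨1, one_pos, max x₀ 1, by positivity, fun z x hz hzx => ?_⟩
      have hz0 : x₀ ≤ z := (le_max_left _ _).trans hz
      simp only [hgdef, ← hb, Real.rpow_zero, one_mul]
      exact hx₀ hz0 (hz0.trans hzx) hzx
    · set D : ℝ → ℝ := fun x => UU (aP p) x - UU (aP p) (x - 1) with hDdef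
      have hDlim : Tendsto (fun x => D x / g x) atTop (𝓝 1) := by
        have := (hU (-1)).neg
        rw [neg_neg] at this
        refine this.congr fun x => ?_
        rw [← sub_eq_add_neg]
        simp only [hDdef]
        ring
      have hev : ∀ᶠ x in atTop, 0 < g x ∧ g x ≤ 2 * D x ∧ D x ≤ 2 * g x := by
        filter_upwards [eventually_gt_atTop 0, (tendsto_order.1 hDlim).1 (1/2) (by norm_num),
          (tendsto_order.1 hDlim).2 2 (by norm_num)] with x hx h1 h2
        have h3 := hg x hx
        rw [lt_div_iff₀ h3] at h1
        rw [div_lt_iff₀ h3] at h2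
        exact ⟨h3, by linarith, by linarith⟩
      have hDr : ∀ c > 0, Tendsto (fun x => D (c * x) / D x) atTop (𝓝 (c ^ β)) := by
        intro c hc
        have ht : Tendsto (fun x : ℝ => c * x) atTop atTop := tendsto_id.const_mul_atTop hc
        have h1 := ((hDlim.comp ht).div hDlim one_ne_zero).mul (hgr c hc)
        rw [div_one, one_mul] at h1
        refine h1.congr' ?_
        filter_upwards [hev, ht.eventually hev] with x ⟨a1, a2, a3⟩ ⟨b1, b2, b3⟩
        have a4 : 0 < D x := by linarith
        simp only [Function.comp, Pi.div_apply]
        field_simp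
      have hDm : Measurable D := by
        have := hm.measurable
        simp only [hDdef]
        fun_prop
      obtain ⟨C, hC, X, hX, hDai⟩ := almostInc_aux D hDm β hb
        (hev.mono fun x hx => by linarith [hx.1, hx.2.1]) hDr
      obtain ⟨Y, hY⟩ := eventually_atTop.1 hev
      refine ⟨4 * C, by positivity, max X Y, lt_of_lt_of_le hX (le_max_left _ _), fun z x hz hzx => ?_⟩
      have hzY : Y ≤ z := (le_max_right _ _).trans hz
      have h1 := hDai z x ((le_max_left _ _).trans hz) hzx
      have h2 := (hY z hzY).2.1
      have h3 := (hY x (hzY.trans hzx)).2.2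
      nlinarith
  have hmain := (GN_lim p hp0 hp β hβ g hg hU hgr hai n).comp Real.tendsto_log_atTop
  refine hmain.congr' ?_
  filter_upwards [eventually_gt_atTop 1] with t ht
  have ht0 : 0 < t := by linarith
  have hx := Real.log_pos ht
  simp only [Function.comp, fJ, GN, cN, hgdef]
  rw [Real.exp_log ht0]
  have e : Real.log t ^ n * (Real.log t ^ β * ℓ (Real.log t)) ^ (n+1) =
      Real.log t ^ (((n+1:ℕ):ℝ) * β + ((n+1:ℕ):ℝ) - 1) * ℓ (Real.log t) ^ (n+1) := by
    rw [mul_pow, ← mul_assoc, ← Real.rpow_natCast (Real.log t) n,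
      ← Real.rpow_natCast (Real.log t ^ β) (n+1), ← Real.rpow_mul hx.le, ← Real.rpow_add hx]
    congr 2
    push_cast
    ring
  rw [e]
  have e2 : (((n+1:ℕ):ℝ)) = (n:ℝ) + 1 := by push_cast; ring
  rw [e2]
  generalize Real.log t ^ (((n:ℝ)+1) * β + ((n:ℝ)+1) - 1) * ℓ (Real.log t) ^ (n+1) = W
  generalize Real.Gamma (β + 1) ^ (n+1) / Real.Gamma (((n:ℝ)+1) * (β + 1)) = V
  rw [mul_div_assoc' V W t, div_div_eq_mul_div]
  ring
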